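/- arXiv:0709.3016 — 3 statements merged into one kernel-verified Lean document; each statement's English description precedes it below -/
import Mathlib

section
/- There exists a topology τ on [ω]^ω such that a set S ⊆ [ω]^ω is nowhere dense with respect to τ if and only if S is a v⁰-set, and moreover S is meager (of the first category) with respect to τ if and only if S is a v⁰-set. -/
open Set

/-- `A`, `B` form a segment when `A ⊆ B` and `B \ A` is infinite. -/
def IsSeg (A B : Set ℕ) : Prop := A ⊆ B ∧ (B \ A).Infinite

/-- The segment `⟨A,B⟩ = {X ∈ [ω]^ω : A ⊆ X ⊆ B}`. -/
def Seg (A B : Set ℕ) : Set (Set ℕ) := {X | X.Infinite ∧ A ⊆ X ∧ X ⊆ B}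

/-- `X ⊆* Y` : the set `X \ Y` is finite. -/
def AlmostSub (X Y : Set ℕ) : Prop := (X \ Y).Finite

/-- The *-segment `⟨A,B⟩* = {X ∈ [ω]^ω : A ⊆* X ⊆* B}`. -/
def StarSeg (A B : Set ℕ) : Set (Set ℕ) := {X | X.Infinite ∧ AlmostSub A X ∧ AlmostSub X B}

/-- `S` is a v⁰-set: every segment contains a segment disjoint from `S`. -/
def IsVZero (S : Set (Set ℕ)) : Prop :=
  ∀ A B, IsSeg A B → ∃ C D, IsSeg C D ∧ Seg C D ⊆ Seg A B ∧ Seg C D ∩ S = ∅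

/-- `S` is a v-set: every segment contains a segment inside `S` or disjoint from `S`. -/
def IsVSet (S : Set (Set ℕ)) : Prop :=
  ∀ A B, IsSeg A B → ∃ C D, IsSeg C D ∧ Seg C D ⊆ Seg A B ∧
    (Seg C D ⊆ S ∨ Seg C D ∩ S = ∅)

theorem IsSeg.seg_subset_seg_iff {A B C D : Set ℕ} (h : IsSeg C D) :
    Seg C D ⊆ Seg A B ↔ A ⊆ C ∧ D ⊆ B := by
  have hD : D.Infinite := h.2.mono sdiff_subset
  refine ⟨fun hs => ⟨fun a ha => ?_, (hs ⟨hD, h.1, subset_rfl⟩).2.2⟩,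
    fun ⟨hA, hB⟩ X hX => ⟨hX.1, hA.trans hX.2.1, hX.2.2.trans hB⟩⟩
  by_contra haC
  have hmem : D \ {a} ∈ Seg C D :=
    ⟨hD.sdiff (finite_singleton a), subset_sdiff_singleton h.1 haC, sdiff_subset⟩
  exact ((hs hmem).2.1 ha).2 rfl

theorem IsVZero.mono {S T : Set (Set ℕ)} (hT : IsVZero T) (hST : S ⊆ T) : IsVZero S := by
  intro A B h
  obtain ⟨C, D, hCD, hsub, hdisj⟩ := hT A B h
  exact ⟨C, D, hCD, hsub, subset_eq_empty (inter_subset_inter_right _ hST) hdisj⟩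

/-- A segment can be shrunk so that all its translates by subsets of a finite set `K`
avoid a given v⁰-set. -/
theorem IsVZero.exists_avoiding_translates {S : Set (Set ℕ)} (hS : IsVZero S) {A B : Set ℕ}
    (hAB : IsSeg A B) {K : Finset ℕ} (hK : Disjoint (K : Set ℕ) B) :
    ∃ C D, IsSeg C D ∧ A ⊆ C ∧ D ⊆ B ∧
      ∀ s ⊆ K, Disjoint (Seg (C ∪ s) (D ∪ s)) S := by
  suffices H : ∀ T : Finset (Finset ℕ), T ⊆ K.powerset → ∃ C D, IsSeg C D ∧ A ⊆ C ∧ D ⊆ B ∧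
      ∀ s ∈ T, Disjoint (Seg (C ∪ s) (D ∪ s)) S by
    simpa using H _ subset_rfl
  intro T
  induction T using Finset.induction_on with
  | empty => exact fun _ => ⟨A, B, hAB, subset_rfl, subset_rfl, by simp⟩
  | insert s T _ ih =>
    intro hT
    obtain ⟨C, D, hCD, hAC, hDB, hdisj⟩ := ih ((Finset.subset_insert _ _).trans hT)
    have hsK : s ⊆ K := Finset.mem_powerset.1 (hT (Finset.mem_insert_self _ _))
    have hsD : Disjoint (s : Set ℕ) D := hK.mono (Finset.coe_subset.2 hsK) hDB
    have hseg : IsSeg (C ∪ s) (D ∪ s) := by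
      refine ⟨union_subset_union_left _ hCD.1, hCD.2.mono fun x hx => ?_⟩
      have := disjoint_right.1 hsD hx.1
      simp_all
    obtain ⟨C', D', hCD', hsub, hempty⟩ := hS _ _ hseg
    obtain ⟨h1, h2⟩ := hCD'.seg_subset_seg_iff.1 hsub
    have hsC' : (s : Set ℕ) ⊆ C' := subset_union_right.trans h1
    have hsD' : (s : Set ℕ) ⊆ D' := hsC'.trans hCD'.1
    have hCC : C ⊆ C' \ s := fun x hx =>
      ⟨h1 (Or.inl hx), disjoint_right.1 hsD (hCD.1 hx)⟩
    have hDD : D' \ s ⊆ D := fun x hx => (h2 hx.1).resolve_right hx.2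
    refine ⟨C' \ s, D' \ s, ⟨sdiff_subset_sdiff_left hCD'.1, hCD'.2.mono fun x hx => ?_⟩,
      hAC.trans hCC, hDD.trans hDB, fun t ht => ?_⟩
    · have hxs : x ∉ (s : Set ℕ) := fun h => hx.2 (hsC' h)
      exact ⟨⟨hx.1, hxs⟩, fun h => hx.2 h.1⟩
    · rcases Finset.mem_insert.1 ht with rfl | ht
      · rw [sdiff_union_of_subset hsC', sdiff_union_of_subset hsD']
        exact disjoint_iff_inter_eq_empty.2 hempty
      · have hsub : Seg (C' \ s ∪ t) (D' \ s ∪ t) ⊆ Seg (C ∪ t) (D ∪ t) := fun X hX =>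
          ⟨hX.1, (union_subset_union_left _ hCC).trans hX.2.1,
            hX.2.2.trans (union_subset_union_left _ hDD)⟩
        exact (hdisj t ht).mono_left hsub

theorem IsVZero.exists_fusion_step {S : Set (Set ℕ)} (hS : IsVZero S) {A B : Set ℕ}
    (hAB : IsSeg A B) {K : Finset ℕ} (hK : Disjoint (K : Set ℕ) B) :
    ∃ C D, ∃ L : Finset ℕ, IsSeg C D ∧ Disjoint (L : Set ℕ) D ∧ A ⊆ C ∧ D ⊆ B ∧
      (∃ k ∈ B, L = insert k K) ∧ ∀ s ⊆ L, Disjoint (Seg (C ∪ s) (D ∪ s)) S := by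
  obtain ⟨k, hkB, hkA⟩ := hAB.2.nonempty
  have hseg : IsSeg A (B \ {k}) := by
    refine ⟨subset_sdiff_singleton hAB.1 hkA, ?_⟩
    rw [sdiff_sdiff_comm]
    exact hAB.2.sdiff (finite_singleton k)
  have hdisj : Disjoint ((insert k K : Finset ℕ) : Set ℕ) (B \ {k}) := by
    rw [Finset.coe_insert, disjoint_insert_left]
    exact ⟨by simp, hK.mono_right sdiff_subset⟩
  obtain ⟨C, D, hCD, hAC, hDB, h⟩ := hS.exists_avoiding_translates hseg hdisj
  exact ⟨C, D, insert k K, hCD, hdisj.mono_right hDB, hAC, hDB.trans sdiff_subset,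
    ⟨k, hkB, rfl⟩, h⟩

theorem IsVZero.iUnion {S : ℕ → Set (Set ℕ)} (hS : ∀ n, IsVZero (S n)) :
    IsVZero (⋃ n, S n) := by
  intro A B hAB
  let State := {p : (Set ℕ × Set ℕ) × Finset ℕ //
    IsSeg p.1.1 p.1.2 ∧ Disjoint (p.2 : Set ℕ) p.1.2}
  have step : ∀ n (p : State), ∃ q : State, p.1.1.1 ⊆ q.1.1.1 ∧ q.1.1.2 ⊆ p.1.1.2 ∧
      (∃ k ∈ p.1.1.2, q.1.2 = insert k p.1.2) ∧
      ∀ s ⊆ q.1.2, Disjoint (Seg (q.1.1.1 ∪ s) (q.1.1.2 ∪ s)) (S n) := by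
    rintro n ⟨⟨⟨A, B⟩, K⟩, hAB, hK⟩
    obtain ⟨C, D, L, h, h', h''⟩ := (hS n).exists_fusion_step hAB hK
    exact ⟨⟨⟨⟨C, D⟩, L⟩, h, h'⟩, h''⟩
  choose F hA hB hK hd using step
  let p : ℕ → State := fun n => Nat.rec ⟨⟨⟨A, B⟩, ∅⟩, hAB, by simp⟩ F n
  let a : ℕ → Set ℕ := fun n => (p n).1.1.1
  let b : ℕ → Set ℕ := fun n => (p n).1.1.2
  let K : ℕ → Finset ℕ := fun n => (p n).1.2
  have ha : Monotone a := monotone_nat_of_le_succ fun n => hA n (p n)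
  have hb : Antitone b := antitone_nat_of_succ_le fun n => hB n (p n)
  have hKs : ∀ n, ∃ k ∈ b n, K (n + 1) = insert k (K n) := fun n => hK n (p n)
  have hds : ∀ n, ∀ s ⊆ K (n + 1), Disjoint (Seg (a (n + 1) ∪ s) (b (n + 1) ∪ s)) (S n) :=
    fun n => hd n (p n)
  have hab : ∀ n, a n ⊆ b n := fun n => (p n).2.1.1
  have hKb : ∀ n, Disjoint (K n : Set ℕ) (b n) := fun n => (p n).2.2
  have hKmono : Monotone K := monotone_nat_of_le_succ fun n => by
    obtain ⟨k, -, hk⟩ := hKs n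
    exact hk ▸ Finset.subset_insert _ _
  have hKcard : ∀ n, (K n).card = n := by
    intro n
    induction n with
    | zero => rfl
    | succ n ih =>
      obtain ⟨k, hkb, hk⟩ := hKs n
      rw [hk, Finset.card_insert_of_notMem fun h => disjoint_left.1 (hKb n) h hkb, ih]
  have hKsub : ∀ m n, (K n : Set ℕ) ⊆ b m ∪ K m := by
    intro m n
    induction n with
    | zero => simp [show K 0 = ∅ from rfl]
    | succ n ih =>
      rcases le_total m n with hmn | hmn
      · obtain ⟨k, hkb, hk⟩ := hKs n
        rw [hk, Finset.coe_insert]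
        exact insert_subset (Or.inl (hb hmn hkb)) ih
      · rcases hmn.eq_or_lt with rfl | hlt
        · obtain ⟨k, hkb, hk⟩ := hKs n
          rw [hk, Finset.coe_insert]
          exact insert_subset (Or.inl hkb) ih
        · exact (Finset.coe_subset.2 (hKmono hlt)).trans subset_union_right
  have hamb : ∀ m n, a m ⊆ b n := fun m n =>
    (ha (le_max_left m n)).trans ((hab _).trans (hb (le_max_right m n)))
  have hdisj : Disjoint (⋃ n, (K n : Set ℕ)) (⋃ n, a n) := by
    simp only [disjoint_iUnion_left, disjoint_iUnion_right]
    exact fun m n => (hKb n).mono_right (hamb m n)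
  have hinf : (⋃ n, (K n : Set ℕ)).Infinite := by
    intro hfin
    have := Finset.card_le_card
      (hfin.subset_toFinset.2 (subset_iUnion (fun n => (K n : Set ℕ)) (hfin.toFinset.card + 1)))
    have := hKcard (hfin.toFinset.card + 1)
    omega
  have hseg : IsSeg (⋃ n, a n) ((⋃ n, a n) ∪ ⋃ n, (K n : Set ℕ)) := by
    refine ⟨subset_union_left, ?_⟩
    rwa [union_sdiff_cancel_left hdisj.symm.le_bot]
  refine ⟨_, _, hseg, hseg.seg_subset_seg_iff.2 ⟨subset_iUnion a 0, ?_⟩, ?_⟩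
  · refine union_subset (iUnion_subset fun n => hamb n 0) (iUnion_subset fun n => ?_)
    simpa [show K 0 = ∅ from rfl, show b 0 = B from rfl] using hKsub 0 n
  · rw [← disjoint_iff_inter_eq_empty, disjoint_iUnion_right]
    refine fun n => disjoint_left.2 fun X hX => ?_
    classical
    refine disjoint_left.1 (hds n {x ∈ K (n + 1) | x ∈ X} (Finset.filter_subset _ _))
      ⟨hX.1, union_subset ((subset_iUnion a (n + 1)).trans hX.2.1) fun x hx => ?_, fun x hx => ?_⟩
    · exact (Finset.mem_filter.1 hx).2
    · rcases hX.2.2 hx with h | h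
      · obtain ⟨m, hm⟩ := mem_iUnion.1 h
        exact Or.inl (hamb m (n + 1) hm)
      · obtain ⟨m, hm⟩ := mem_iUnion.1 h
        exact (hKsub (n + 1) m hm).imp id fun h => Finset.mem_coe.2 (Finset.mem_filter.2 ⟨h, hx⟩)

/-- The rationals below `r`, and a sequence of rationals decreasing to `r`. -/
theorem exists_infinite_rat_above (r : ℝ) :
    ∃ F : Set ℚ, F.Infinite ∧ (∀ x ∈ F, r < x) ∧ ∀ s > r, {x ∈ F | s ≤ (x : ℝ)}.Finite := by
  obtain ⟨u, hu, hr, hlim⟩ := Real.exists_seq_rat_strictAnti_tendsto r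
  refine ⟨range u, infinite_range_of_injective hu.injective, by simpa using hr, fun s hs => ?_⟩
  obtain ⟨N, hN⟩ := Filter.eventually_atTop.1 (hlim.eventually_lt_const hs)
  refine ((finite_Iio N).image u).subset ?_
  rintro _ ⟨⟨n, rfl⟩, hn⟩
  exact ⟨n, not_le.1 fun h => (hN n h).not_ge hn, rfl⟩

/-- Every segment contains a family of segments indexed by the reals such that each pair `C`, `D`
has a nonempty but finite intersection with only finitely many of them. -/
theorem IsSeg.exists_real_family {A B : Set ℕ} (hAB : IsSeg A B) :
    ∃ q : ℝ → Set ℕ × Set ℕ, (∀ r, IsSeg (q r).1 (q r).2 ∧ A ⊆ (q r).1 ∧ (q r).2 ⊆ B) ∧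
      ∀ C D : Set ℕ, {r | C ∪ (q r).1 ⊆ D ∩ (q r).2 ∧
        ((D ∩ (q r).2) \ (C ∪ (q r).1)).Finite}.Finite := by
  obtain ⟨e, he⟩ : ∃ e : ℚ ↪ ℕ, ∀ x, e x ∈ B \ A :=
    ⟨(Encodable.encode' ℚ).trans ((hAB.2.natEmbedding _).trans (Function.Embedding.subtype _)),
      fun x => Subtype.prop _⟩
  choose F hFinf hFr hFfin using exists_infinite_rat_above
  let c : ℝ → Set ℕ := fun r => A ∪ e '' {x : ℚ | (x : ℝ) < r}
  have hmem_c : ∀ r x, e x ∈ c r ↔ (x : ℝ) < r := by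
    intro r x
    simp [c, (he x).2]
  have hmem_d : ∀ r x, e x ∈ c r ∪ e '' F r ↔ (x : ℝ) < r ∨ x ∈ F r := by
    intro r x
    rw [mem_union, hmem_c, e.injective.mem_set_image]
  refine ⟨fun r => (c r, c r ∪ e '' F r), fun r => ⟨⟨subset_union_left, ?_⟩, subset_union_left, ?_⟩,
    fun C D => ?_⟩
  · refine ((hFinf r).image e.injective.injOn).mono ?_
    rintro _ ⟨x, hx, rfl⟩
    exact ⟨Or.inr ⟨x, hx, rfl⟩, fun h => ((hmem_c r x).1 h).not_gt (hFr r x hx)⟩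
  · refine union_subset (union_subset hAB.1 ?_) ?_ <;> rintro _ ⟨x, -, rfl⟩ <;> exact (he x).1
  · by_contra hinf
    obtain ⟨t, ht, hcard⟩ := Set.Infinite.exists_subset_card_eq hinf 3
    let f := t.orderEmbOfFin hcard
    have hf : ∀ i, f i ∈ {r | C ∪ c r ⊆ D ∩ (c r ∪ e '' F r) ∧
        ((D ∩ (c r ∪ e '' F r)) \ (C ∪ c r)).Finite} := fun i => ht (t.orderEmbOfFin_mem hcard i)
    have h01 : f 0 < f 1 := f.strictMono (by decide)
    have h12 : f 1 < f 2 := f.strictMono (by decide)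
    have hfin1 : {x ∈ F (f 1) | e x ∈ D \ C}.Finite := by
      refine ((hf 1).2.preimage e.injective.injOn).subset fun x hx => ?_
      refine ⟨⟨hx.2.1, (hmem_d _ _).2 (Or.inr hx.1)⟩, ?_⟩
      rintro (h | h)
      · exact hx.2.2 h
      · exact ((hmem_c _ _).1 h).not_gt (hFr _ x hx.1)
    obtain ⟨x, hx, hx'⟩ := ((hFinf (f 1)).sdiff
      ((hfin1.union (hFfin _ _ h12)).union (hFfin _ _ h01))).nonempty
    have hx1 := hFr _ x hx
    simp only [mem_union, mem_ofPred_eq, not_or, not_and] at hx'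
    obtain ⟨⟨hDC, hlt⟩, hF0⟩ := hx'
    have hD : e x ∈ D := ((hf 2).1 (Or.inr ((hmem_c _ _).2 (not_le.1 (hlt hx))))).1
    have hC : e x ∈ C := by
      by_contra hC
      exact hDC hx ⟨hD, hC⟩
    rcases (hmem_d _ _).1 ((hf 0).1 (Or.inl hC)).2 with h | h
    · exact absurd h (h01.trans hx1).not_gt
    · exact hF0 h hx1.le

open Cardinal in
theorem exists_notMem_of_mk_lt_continuum {s : Set ℝ} (hs : #s < 𝔠) : ∃ r, r ∉ s := by
  refine (ne_univ_iff_exists_notMem s).1 ?_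
  rintro rfl
  rw [mk_univ, mk_real] at hs
  exact hs.false

open Cardinal in
theorem mk_iUnion_finset_lt_continuum {I : Type} (hI : #I < 𝔠) {s : Finset I → Set ℝ}
    (hs : ∀ t, (s t).Finite) : #(⋃ t, s t) < 𝔠 := by
  refine (mk_iUnion_le s).trans_lt (mul_lt_of_lt aleph0_le_continuum ?_ ?_)
  · cases finite_or_infinite I
    · exact (mk_lt_aleph0 (α := Finset I)).trans aleph0_lt_continuum
    · rwa [mk_finset_of_infinite]
  · exact (ciSup_le' fun t => (hs t).lt_aleph0.le).trans_lt aleph0_lt_continuum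

open Cardinal in
/-- If each pair `C`, `D` has a nonempty but finite intersection with only finitely many members
of each family `q i`, then one can select a member of each family so that any finitely many of
the selected ones have an empty or infinite intersection. -/
theorem exists_selection_inter_infinite {I : Type} (hI : #I ≤ 𝔠) (q : I → ℝ → Set ℕ × Set ℕ)
    (hfin : ∀ i, ∀ C D : Set ℕ, {r | C ∪ (q i r).1 ⊆ D ∩ (q i r).2 ∧
      ((D ∩ (q i r).2) \ (C ∪ (q i r).1)).Finite}.Finite) :
    ∃ f : I → ℝ, ∀ t : Finset I,
      (⋃ i ∈ t, (q i (f i)).1) ⊆ ⋂ i ∈ t, (q i (f i)).2 →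
        ((⋂ i ∈ t, (q i (f i)).2) \ ⋃ i ∈ t, (q i (f i)).1).Infinite := by
  classical
  obtain ⟨_, _, hord⟩ := exists_ord_eq_type_lt I
  have key : ∀ a (g : ∀ b, b < a → ℝ), ∃ r, ∀ t : Finset (Iio a),
      (⋃ i ∈ t, (q i (g i (mem_Iio.1 i.2))).1) ∪ (q a r).1 ⊆ (⋂ i ∈ t, (q i (g i (mem_Iio.1 i.2))).2) ∩ (q a r).2 →
        (((⋂ i ∈ t, (q i (g i (mem_Iio.1 i.2))).2) ∩ (q a r).2) \
          ((⋃ i ∈ t, (q i (g i (mem_Iio.1 i.2))).1) ∪ (q a r).1)).Infinite := by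
    intro a g
    have hlt := mk_iUnion_finset_lt_continuum ((mk_Iio_lt a hord).trans_le hI)
      fun t : Finset (Iio a) => hfin a (⋃ i ∈ t, (q i (g i (mem_Iio.1 i.2))).1) (⋂ i ∈ t, (q i (g i (mem_Iio.1 i.2))).2)
    obtain ⟨r, hr⟩ := exists_notMem_of_mk_lt_continuum hlt
    exact ⟨r, fun t hsub hf => hr (mem_iUnion_of_mem t ⟨hsub, hf⟩)⟩
  choose F hF using key
  let f := (wellFounded_lt (α := I)).fix F
  have hf : ∀ a, f a = F a fun b _ => f b := wellFounded_lt.fix_eq F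
  refine ⟨f, fun t => ?_⟩
  induction t using Finset.induction_on_max with
  | empty => simpa using infinite_univ
  | insert a s hs _ =>
    lift s to Finset (Iio a) using hs
    have := hF a (fun b _ => f b) s
    rw [← hf] at this
    simpa [inter_comm, union_comm] using this

open Cardinal in
/-- There is a family of segments, dense among all segments, any finitely many of which have
an intersection that is either empty or a segment. -/
theorem exists_dense_segment_family :
    ∃ q : {p : Set ℕ × Set ℕ // IsSeg p.1 p.2} → Set ℕ × Set ℕ,
      (∀ p, IsSeg (q p).1 (q p).2 ∧ p.1.1 ⊆ (q p).1 ∧ (q p).2 ⊆ p.1.2) ∧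
      ∀ t : Finset {p : Set ℕ × Set ℕ // IsSeg p.1 p.2},
        (⋃ i ∈ t, (q i).1) ⊆ ⋂ i ∈ t, (q i).2 →
          ((⋂ i ∈ t, (q i).2) \ ⋃ i ∈ t, (q i).1).Infinite := by
  choose q hq hfin using fun p : {p : Set ℕ × Set ℕ // IsSeg p.1 p.2} => p.2.exists_real_family
  obtain ⟨f, hf⟩ := exists_selection_inter_infinite ((mk_subtype_le _).trans (by simp)) q hfin
  exact ⟨fun p => q p (f p), fun p => hq p (f p), hf⟩

theorem isNowhereDense_iff_forall_exists_disjoint {X : Type*} [TopologicalSpace X] {S : Set X} :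
    IsNowhereDense S ↔ ∀ U, IsOpen U → U.Nonempty →
      ∃ V ⊆ U, IsOpen V ∧ V.Nonempty ∧ Disjoint V S := by
  refine ⟨fun h U hU hne => ?_, fun h => not_nonempty_iff_eq_empty.1 fun hne => ?_⟩
  · refine ⟨U \ closure S, sdiff_subset, hU.sdiff isClosed_closure, ?_,
      disjoint_sdiff_left.mono_right subset_closure⟩
    rw [sdiff_nonempty]
    exact fun hsub => hne.ne_empty (subset_eq_empty (interior_maximal hsub hU) h)
  · obtain ⟨V, hVU, hV, ⟨x, hx⟩, hdisj⟩ := h _ isOpen_interior hne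
    exact disjoint_left.1 (hdisj.closure_right hV) hx (interior_subset (hVU hx))

/-- If segments and nonempty open sets are dense in each other, then the nowhere dense sets
are the v⁰-sets. -/
theorem isNowhereDense_iff_isVZero [TopologicalSpace {X : Set ℕ // X.Infinite}]
    (hopen : ∀ U : Set {X : Set ℕ // X.Infinite}, IsOpen U → U.Nonempty →
      ∃ A B, IsSeg A B ∧ Seg A B ⊆ Subtype.val '' U)
    (hseg : ∀ A B, IsSeg A B →
      ∃ U : Set {X : Set ℕ // X.Infinite}, IsOpen U ∧ U.Nonempty ∧ Subtype.val '' U ⊆ Seg A B)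
    {S : Set {X : Set ℕ // X.Infinite}} :
    IsNowhereDense S ↔ IsVZero (Subtype.val '' S) := by
  rw [isNowhereDense_iff_forall_exists_disjoint]
  constructor
  · intro h A B hAB
    obtain ⟨U, hU, hne, hsub⟩ := hseg A B hAB
    obtain ⟨V, hVU, hV, hVne, hdisj⟩ := h U hU hne
    obtain ⟨C, D, hCD, hCDV⟩ := hopen V hV hVne
    refine ⟨C, D, hCD, hCDV.trans ((image_mono hVU).trans hsub), ?_⟩
    exact disjoint_iff_inter_eq_empty.1
      (((disjoint_image_iff Subtype.val_injective).2 hdisj).mono_left hCDV)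
  · intro h U hU hne
    obtain ⟨A, B, hAB, hsub⟩ := hopen U hU hne
    obtain ⟨C, D, hCD, hCDAB, hempty⟩ := h A B hAB
    obtain ⟨V, hV, hVne, hVsub⟩ := hseg C D hCD
    refine ⟨V, ?_, hV, hVne, ?_⟩
    · exact (image_subset_image_iff Subtype.val_injective).1 (hVsub.trans (hCDAB.trans hsub))
    · exact (disjoint_image_iff Subtype.val_injective).1
        ((disjoint_iff_inter_eq_empty.2 hempty).mono_left hVsub)

/-- There is a topology on `[ω]^ω` whose nowhere dense sets, as well as meager sets,
are exactly the v⁰-sets. -/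
theorem exists_segment_topology :
    ∃ τ : TopologicalSpace {X : Set ℕ // X.Infinite},
      ∀ S : Set {X : Set ℕ // X.Infinite},
        (@IsNowhereDense _ τ S ↔ IsVZero (Subtype.val '' S)) ∧
        (@IsMeagre _ τ S ↔ IsVZero (Subtype.val '' S)) := by
  obtain ⟨q, hq, hinter⟩ := exists_dense_segment_family
  let O : {p : Set ℕ × Set ℕ // IsSeg p.1 p.2} → Set {X : Set ℕ // X.Infinite} :=
    fun p => Subtype.val ⁻¹' Seg (q p).1 (q p).2
  let τ := TopologicalSpace.generateFrom (range O)
  have hnd : ∀ S : Set {X : Set ℕ // X.Infinite},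
      IsNowhereDense S ↔ IsVZero (Subtype.val '' S) := by
    refine fun S => isNowhereDense_iff_isVZero (fun U hU ⟨x, hx⟩ => ?_) fun A B hAB => ?_
    · obtain ⟨_, ⟨f, ⟨hf, hfO⟩, rfl⟩, hxf, hfU⟩ :=
        (TopologicalSpace.isTopologicalBasis_of_subbasis (t := τ) rfl).exists_subset_of_mem_open
          hx hU
      classical
      lift f to Finset (Set {X : Set ℕ // X.Infinite}) using hf
      rw [← image_univ, Finset.subset_set_image_iff] at hfO
      obtain ⟨t, -, rfl⟩ := hfO
      simp only [Finset.coe_image, sInter_image, Finset.mem_coe] at hxf hfU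
      have hxt : ∀ i ∈ t, x ∈ O i := mem_iInter₂.1 hxf
      have hsub : (⋃ i ∈ t, (q i).1) ⊆ ⋂ i ∈ t, (q i).2 :=
        (iUnion₂_subset fun i hi => (hxt i hi).2.1).trans
          (subset_iInter₂ fun i hi => (hxt i hi).2.2)
      refine ⟨_, _, ⟨hsub, hinter t hsub⟩, fun X hX => ⟨⟨X, hX.1⟩, hfU ?_, rfl⟩⟩
      exact mem_iInter₂.2 fun i hi => ⟨hX.1,
        (subset_biUnion_of_mem (u := fun i => (q i).1) hi).trans hX.2.1,
        hX.2.2.trans (biInter_subset_of_mem hi)⟩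
    · obtain ⟨hseg, hA, hB⟩ := hq ⟨(A, B), hAB⟩
      have hinf := hseg.2.mono sdiff_subset
      refine ⟨O ⟨(A, B), hAB⟩, .basic _ ⟨_, rfl⟩, ⟨⟨_, hinf⟩, hinf, hseg.1, subset_rfl⟩, ?_⟩
      exact (image_preimage_subset _ _).trans (hseg.seg_subset_seg_iff.2 ⟨hA, hB⟩)
  refine ⟨τ, fun S => ⟨hnd S, fun h => ?_, fun h => ((hnd S).2 h).isMeagre⟩⟩
  obtain ⟨T, hT, hTc, hST⟩ := isMeagre_iff_countable_union_isNowhereDense.1 h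
  obtain ⟨s, hs⟩ := (hTc.insert ∅).exists_eq_range (insert_nonempty _ _)
  have hsnd : ∀ n, IsVZero (Subtype.val '' s n) := fun n => by
    rw [← hnd]
    rcases hs.ge (mem_range_self n) with h | h
    · exact h ▸ isNowhereDense_empty
    · exact hT _ h
  refine (IsVZero.iUnion hsnd).mono ?_
  rw [← image_iUnion, ← sUnion_range, ← hs]
  exact image_mono (hST.trans (sUnion_mono (subset_insert _ _)))
end

section
/- If S ⊆ [ω]^ω is a v⁰-set, then for every segment ⟨A,B⟩ there exists a segment ⟨C,D⟩ ⊆ ⟨A,B⟩ such that ⟨C,D⟩* ∩ S* = ∅. -/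
open Set

/-- `S* = {Y ∈ [ω]^ω : ∃ X ∈ S, X ⊆* Y ⊆* X}`. -/
def SetStar (S : Set (Set ℕ)) : Set (Set ℕ) :=
  {Y | Y.Infinite ∧ ∃ X ∈ S, AlmostSub X Y ∧ AlmostSub Y X}

theorem IsSeg.subset_of_seg_subset {A B C D : Set ℕ} (h : IsSeg C D)
    (hs : Seg C D ⊆ Seg A B) : A ⊆ C ∧ D ⊆ B := by
  refine ⟨fun a ha => ?_, (hs ⟨h.2.mono sdiff_subset, h.1, subset_rfl⟩).2.2⟩
  by_contra hc
  have hinf : (D \ {a}).Infinite := (h.2.mono sdiff_subset).sdiff (finite_singleton a)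
  have hmem : D \ {a} ∈ Seg C D :=
    ⟨hinf, fun x hx => ⟨h.1 hx, fun hxa => hc (hxa ▸ hx)⟩, sdiff_subset⟩
  exact ((hs hmem).2.1 ha).2 rfl

/-- A segment can be shrunk above `m`, without deciding any point below `m`, so that every
infinite set lying in it above `m` whose trace below `m` belongs to `T` avoids `S`. -/
theorem IsVZero.exists_avoiding_traces {S : Set (Set ℕ)} (hS : IsVZero S) (m : ℕ)
    {T : Set (Set ℕ)} (hT : T.Finite) {A B : Set ℕ} (h : IsSeg A B) :
    ∃ C D, IsSeg C D ∧ A ⊆ C ∧ D ⊆ B ∧ (∀ x < m, x ∈ B \ A → x ∈ D \ C) ∧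
      ∀ X : Set ℕ, X.Infinite → X ∩ Iio m ∈ T → C \ Iio m ⊆ X → X \ Iio m ⊆ D → X ∉ S := by
  induction T, hT using Set.Finite.induction_on with
  | empty =>
    exact ⟨A, B, h, subset_rfl, subset_rfl, fun _ _ hx => hx, fun _ _ hX => hX.elim⟩
  | @insert s T _ _ ih =>
    obtain ⟨C, D, hCD, hAC, hDB, hkeep, hav⟩ := ih
    have hseg : IsSeg (C \ Iio m ∪ (s ∩ Iio m)) (D \ Iio m ∪ (s ∩ Iio m)) := by
      refine ⟨union_subset_union_left _ (sdiff_subset_sdiff_left hCD.1),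
        (hCD.2.sdiff (finite_Iio m)).mono ?_⟩
      rintro x ⟨⟨hxD, hxC⟩, hxm⟩
      exact ⟨Or.inl ⟨hxD, hxm⟩, fun hx => hx.elim (fun hx => hxC hx.1) fun hx => hxm hx.2⟩
    obtain ⟨E, F, hEF, hsub, hdisj⟩ := hS _ _ hseg
    obtain ⟨hCE, hFD⟩ := hEF.subset_of_seg_subset hsub
    have hCE' : ∀ x ∈ C, ¬ x < m → x ∈ E := fun x hx hm => hCE (Or.inl ⟨hx, hm⟩)
    have hFD' : ∀ x ∈ F, ¬ x < m → x ∈ D := fun x hx hm =>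
      (hFD hx).elim (fun hx => hx.1) fun hx => (hm hx.2).elim
    refine ⟨(C ∩ Iio m) ∪ (E \ Iio m), (D ∩ Iio m) ∪ (F \ Iio m), ⟨?_, ?_⟩, ?_, ?_, ?_, ?_⟩
    · exact union_subset_union (inter_subset_inter_left _ hCD.1) (sdiff_subset_sdiff_left hEF.1)
    · refine (hEF.2.sdiff (finite_Iio m)).mono ?_
      rintro x ⟨⟨hxF, hxE⟩, hxm⟩
      exact ⟨Or.inr ⟨hxF, hxm⟩, fun hx => hx.elim (fun hx => hxm hx.2) fun hx => hxE hx.1⟩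
    · intro x hx
      by_cases hm : x < m
      · exact Or.inl ⟨hAC hx, hm⟩
      · exact Or.inr ⟨hCE' x (hAC hx) hm, hm⟩
    · rintro x (hx | hx)
      · exact hDB hx.1
      · exact hDB (hFD' x hx.1 hx.2)
    · intro x hm hx
      have hx' := hkeep x hm hx
      exact ⟨Or.inl ⟨hx'.1, hm⟩, fun h => h.elim (fun h => hx'.2 h.1) fun h => h.2 hm⟩
    · intro X hX htr hlow hupp
      have hlow' : ∀ x ∈ E, ¬ x < m → x ∈ X := fun x hx hm => hlow ⟨Or.inr ⟨hx, hm⟩, hm⟩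
      have hupp' : ∀ x ∈ X, ¬ x < m → x ∈ F := fun x hx hm =>
        (hupp ⟨hx, hm⟩).elim (fun h => (hm h.2).elim) fun h => h.1
      rcases htr with rfl | htr
      · intro hXS
        refine (hdisj.subset ⟨⟨hX, fun x hx => ?_, fun x hx => ?_⟩, hXS⟩ : X ∈ (∅ : Set (Set ℕ)))
        · by_cases hm : x < m
          · rcases hFD (hEF.1 hx) with hx | hx
            · exact (hx.2 hm).elim
            · exact hx.1.1
          · exact hlow' x hx hm
        · by_cases hm : x < m
          · exact hEF.1 (hCE (Or.inr ⟨⟨hx, hm⟩, hm⟩))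
          · exact hupp' x hx hm
      · exact hav X hX htr (fun x hx => hlow' x (hCE' x hx.1 hx.2) hx.2)
          fun x hx => hFD' x (hupp' x hx.1 hx.2) hx.2

/-- A segment can be shrunk above `m`, without deciding any point below `m`, so that every
infinite set lying in it above `m` avoids `S`. -/
theorem IsVZero.exists_avoiding_above {S : Set (Set ℕ)} (hS : IsVZero S) (m : ℕ)
    {A B : Set ℕ} (h : IsSeg A B) :
    ∃ C D, IsSeg C D ∧ A ⊆ C ∧ D ⊆ B ∧ (∀ x < m, x ∈ B \ A → x ∈ D \ C) ∧
      ∀ X : Set ℕ, X.Infinite → C \ Iio m ⊆ X → X \ Iio m ⊆ D → X ∉ S := by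
  obtain ⟨C, D, h₁, h₂, h₃, h₄, h₅⟩ :=
    hS.exists_avoiding_traces m (finite_Iio m).finite_subsets h
  exact ⟨C, D, h₁, h₂, h₃, h₄, fun X hX => h₅ X hX inter_subset_right⟩

theorem AlmostSub.trans {X Y Z : Set ℕ} (h₁ : AlmostSub X Y) (h₂ : AlmostSub Y Z) :
    AlmostSub X Z := by
  refine (Set.Finite.union h₁ h₂).subset fun x hx => ?_
  by_cases hy : x ∈ Y
  · exact Or.inr ⟨hy, hx.2⟩
  · exact Or.inl ⟨hx.1, hy⟩

theorem AlmostSub.infinite {X Y : Set ℕ} (h : AlmostSub X Y) (hX : X.Infinite) :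
    Y.Infinite := fun hY =>
  hX ((Set.Finite.union h hY).subset fun x hx => by
    by_cases hy : x ∈ Y
    · exact Or.inr hy
    · exact Or.inl ⟨hx, hy⟩)

theorem starSeg_inter_setStar_eq_empty {S : Set (Set ℕ)} {C D : Set ℕ}
    (h : StarSeg C D ∩ S = ∅) : StarSeg C D ∩ SetStar S = ∅ := by
  refine eq_empty_of_forall_notMem ?_
  rintro Y ⟨⟨hY, hCY, hYD⟩, -, X, hXS, hXY, hYX⟩
  exact h.subset ⟨⟨hYX.infinite hY, hCY.trans hYX, hXY.trans hYD⟩, hXS⟩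

/-- The fusion sequence: segments `⟨A n, B n⟩` and levels `m n`. -/
theorem IsVZero.exists_fusion {S : Set (Set ℕ)} (hS : IsVZero S) {A₀ B₀ : Set ℕ}
    (h : IsSeg A₀ B₀) :
    ∃ (m : ℕ → ℕ) (A B : ℕ → Set ℕ), StrictMono m ∧ Monotone A ∧ Antitone B ∧
      A 0 = A₀ ∧ B 0 = B₀ ∧ (∀ n, A n ⊆ B n) ∧
      (∀ n, ∀ x < m n, x ∈ B n \ A n → x ∈ B (n + 1) \ A (n + 1)) ∧
      (∀ n, ∃ x ∈ B (n + 1) \ A (n + 1), m n ≤ x ∧ x < m (n + 1)) ∧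
      ∀ n, ∀ X : Set ℕ, X.Infinite → A (n + 1) \ Iio (m n) ⊆ X →
        X \ Iio (m n) ⊆ B (n + 1) → X ∉ S := by
  have step : ∀ p : {p : ℕ × Set ℕ × Set ℕ // IsSeg p.2.1 p.2.2},
      ∃ q : {p : ℕ × Set ℕ × Set ℕ // IsSeg p.2.1 p.2.2},
        p.1.1 < q.1.1 ∧ p.1.2.1 ⊆ q.1.2.1 ∧ q.1.2.2 ⊆ p.1.2.2 ∧
        (∀ x < p.1.1, x ∈ p.1.2.2 \ p.1.2.1 → x ∈ q.1.2.2 \ q.1.2.1) ∧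
        (∃ x ∈ q.1.2.2 \ q.1.2.1, p.1.1 ≤ x ∧ x < q.1.1) ∧
        ∀ X : Set ℕ, X.Infinite → q.1.2.1 \ Iio p.1.1 ⊆ X → X \ Iio p.1.1 ⊆ q.1.2.2 →
          X ∉ S := by
    rintro ⟨⟨m, A, B⟩, hAB⟩
    obtain ⟨C, D, h₁, h₂, h₃, h₄, h₅⟩ := hS.exists_avoiding_above m hAB
    obtain ⟨x, hx, hmx⟩ := h₁.2.exists_gt m
    exact ⟨⟨⟨x + 1, C, D⟩, h₁⟩, hmx.trans x.lt_succ_self, h₂, h₃, h₄,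
      ⟨x, hx, hmx.le, x.lt_succ_self⟩, h₅⟩
  choose next hlt hA hB hkeep hnew hav using step
  let f : ℕ → {p : ℕ × Set ℕ × Set ℕ // IsSeg p.2.1 p.2.2} :=
    fun n => Nat.rec ⟨⟨0, A₀, B₀⟩, h⟩ (fun _ p => next p) n
  exact ⟨fun n => (f n).1.1, fun n => (f n).1.2.1, fun n => (f n).1.2.2,
    strictMono_nat_of_lt_succ fun n => hlt (f n), monotone_nat_of_le_succ fun n => hA (f n),
    antitone_nat_of_succ_le fun n => hB (f n), rfl, rfl, fun n => (f n).2.1,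
    fun n => hkeep (f n), fun n => hnew (f n), fun n => hav (f n)⟩

/-- Lemma 8: for a v⁰-set `S`, every segment contains a segment whose *-segment
misses `S*`. -/
theorem vZero_starSeg_avoids_setStar (S : Set (Set ℕ)) (hS : IsVZero S)
    (A B : Set ℕ) (h : IsSeg A B) :
    ∃ C D, IsSeg C D ∧ Seg C D ⊆ Seg A B ∧ StarSeg C D ∩ SetStar S = ∅ := by
  obtain ⟨m, A', B', hm, hA, hB, rfl, rfl, hAB, hkeep, hnew, hav⟩ := hS.exists_fusion h
  have hkeep' : ∀ i j, i ≤ j → ∀ x < m i, x ∈ B' i \ A' i → x ∈ B' j \ A' j := by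
    intro i j hij x hx hxi
    induction j, hij using Nat.le_induction with
    | base => exact hxi
    | succ j hij ih => exact hkeep j x (hx.trans_le (hm.monotone hij)) ih
  refine ⟨⋃ n, A' n, ⋂ n, B' n, ⟨?_, ?_⟩, ?_, starSeg_inter_setStar_eq_empty ?_⟩
  · refine iUnion_subset fun i => subset_iInter fun j => ?_
    exact (hA (le_max_left i j)).trans ((hAB _).trans (hB (le_max_right i j)))
  · refine infinite_of_forall_exists_gt fun a => ?_
    obtain ⟨x, hx, hax, hxm⟩ := hnew (a + 1)
    have hmem : ∀ j, x ∈ B' j \ A' j := by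
      intro j
      have hj := hkeep' _ _ (le_max_left (a + 1 + 1) j) x hxm hx
      exact ⟨hB (le_max_right _ _) hj.1, fun hxj => hj.2 (hA (le_max_right _ _) hxj)⟩
    refine ⟨x, ⟨mem_iInter.2 fun j => (hmem j).1, fun hxA => ?_⟩, ?_⟩
    · obtain ⟨j, hj⟩ := mem_iUnion.1 hxA
      exact (hmem j).2 hj
    · exact (Nat.lt_succ_self a).trans_le ((hm.le_apply).trans hax)
  · rintro X ⟨hX, hCX, hXD⟩
    exact ⟨hX, (subset_iUnion A' 0).trans hCX, hXD.trans (iInter_subset B' 0)⟩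
  · refine eq_empty_of_forall_notMem ?_
    rintro X ⟨⟨hX, hCX, hXD⟩, hXS⟩
    obtain ⟨k, hk⟩ := (Set.Finite.union hCX hXD).bddAbove
    have hlt : ∀ x, ¬ x < m (k + 1) → x ∉ ((⋃ n, A' n) \ X) ∪ (X \ ⋂ n, B' n) :=
      fun x hx hmem => hx (((hk hmem).trans_lt k.lt_succ_self).trans_le hm.le_apply)
    refine hav (k + 1) X hX (fun x hx => ?_) (fun x hx => ?_) hXS
    · by_contra hxX
      exact hlt x hx.2 (Or.inl ⟨mem_iUnion.2 ⟨_, hx.1⟩, hxX⟩)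
    · by_contra hxB
      exact hlt x hx.2 (Or.inr ⟨hx.1, fun hxD => hxB (mem_iInter.1 hxD _)⟩)
end

section
/- κ(v) ≤ h, where h is the distributivity number of ([ω]^ω, ⊆*). -/
open Set

/-- A set of infinite subsets of `ℕ` is a *-segment if it is of the form `⟨A,B⟩*`. -/
def IsStarSeg (P : Set (Set ℕ)) : Prop := ∃ A B, IsSeg A B ∧ P = StarSeg A B

/-- Two *-segments are *-disjoint when their intersection is countable. -/
def StarDisjoint (P Q : Set (Set ℕ)) : Prop := (P ∩ Q).Countable

/-- A v-partition: a maximal family of pairwise *-disjoint *-segments. -/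
def IsVPartition (P : Set (Set (Set ℕ))) : Prop :=
  (∀ X ∈ P, IsStarSeg X) ∧
  (∀ X ∈ P, ∀ Y ∈ P, X ≠ Y → StarDisjoint X Y) ∧
  (∀ R, IsStarSeg R → R ∉ P → ∃ X ∈ P, ¬ StarDisjoint R X)

/-- `P` refines `Q`: every member of `P` is contained in some member of `Q`. -/
def Refines (P Q : Set (Set (Set ℕ))) : Prop := ∀ X ∈ P, ∃ Y ∈ Q, X ⊆ Y

/-- A v-matrix is a collection of v-partitions. -/
def IsVMatrix (H : Set (Set (Set (Set ℕ)))) : Prop := ∀ P ∈ H, IsVPartition P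

/-- A v-matrix `H` is shattering: for every *-segment `⟨A,B⟩*` some partition in `H`
has two distinct members whose intersections with `⟨A,B⟩*` are two different *-segments. -/
def Shattering (H : Set (Set (Set (Set ℕ)))) : Prop :=
  IsVMatrix H ∧ ∀ A B, IsSeg A B → ∃ P ∈ H, ∃ X ∈ P, ∃ Y ∈ P, X ≠ Y ∧
    IsStarSeg (X ∩ StarSeg A B) ∧ IsStarSeg (Y ∩ StarSeg A B) ∧
    X ∩ StarSeg A B ≠ Y ∩ StarSeg A B

/-- `κ(v)`: the least cardinality of a shattering v-matrix. -/
noncomputable def kappaV : Cardinal :=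
  sInf {c : Cardinal | ∃ H : Set (Set (Set (Set ℕ))), Shattering H ∧ Cardinal.mk ↥H = c}

/-- `D` is dense in `([ω]^ω, ⊆*)`: every infinite set has an infinite subset in `D`. -/
def DenseIn (D : Set (Set ℕ)) : Prop :=
  ∀ X : Set ℕ, X.Infinite → ∃ A ∈ D, A.Infinite ∧ A ⊆ X

/-- `D` is open in `([ω]^ω, ⊆*)`: closed under almost-subsets. -/
def OpenIn (D : Set (Set ℕ)) : Prop :=
  ∀ B ∈ D, ∀ A : Set ℕ, A.Infinite → AlmostSub A B → A ∈ D

/-- The distributivity number `h` of `([ω]^ω, ⊆*)`. -/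
noncomputable def hNum : Cardinal :=
  sInf {c : Cardinal | ∃ Ds : Set (Set (Set ℕ)),
    (∀ D ∈ Ds, (∀ A ∈ D, Set.Infinite A) ∧ OpenIn D ∧ DenseIn D) ∧
    ¬ DenseIn (⋂₀ Ds) ∧ Cardinal.mk ↥Ds = c}

theorem AlmostSub.of_subset {X Y : Set ℕ} (h : X ⊆ Y) : AlmostSub X Y := by
  simp [AlmostSub, Set.sdiff_eq_empty.2 h]

theorem AlmostSub.union {X Y Z : Set ℕ} (h₁ : AlmostSub X Z) (h₂ : AlmostSub Y Z) :
    AlmostSub (X ∪ Y) Z := by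
  rw [AlmostSub, Set.union_sdiff_distrib]
  exact Set.Finite.union h₁ h₂

theorem AlmostSub.inter {X Y Z : Set ℕ} (h₁ : AlmostSub X Y) (h₂ : AlmostSub X Z) :
    AlmostSub X (Y ∩ Z) := by
  rw [AlmostSub, Set.sdiff_inter]
  exact Set.Finite.union h₁ h₂

theorem StarSeg.subset_of_almostSub {A B C E : Set ℕ} (hA : AlmostSub A C) (hB : AlmostSub E B) :
    StarSeg C E ⊆ StarSeg A B :=
  fun _ hX => ⟨hX.1, hA.trans hX.2.1, hX.2.2.trans hB⟩

theorem Set.Infinite.exists_infinite_subset_infinite_diff {F : Set ℕ} (hF : F.Infinite) :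
    ∃ G ⊆ F, G.Infinite ∧ (F \ G).Infinite := by
  let g := Nat.nth (· ∈ F)
  have hg : Function.Injective g := Nat.nth_injective hF
  have hm : ∀ n, g n ∈ F := Nat.nth_mem_of_infinite hF
  refine ⟨Set.range fun n => g (2 * n), ?_, ?_, ?_⟩
  · rintro _ ⟨n, rfl⟩
    exact hm _
  · exact Set.infinite_range_of_injective fun a b h => by have := hg h; omega
  · refine (Set.infinite_range_of_injective (f := fun n => g (2 * n + 1)) fun a b h => by
      have := hg h; omega).mono ?_
    rintro _ ⟨n, rfl⟩
    refine ⟨hm _, ?_⟩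
    rintro ⟨m, h⟩
    have := hg h
    omega

theorem not_countable_starSeg {A B : Set ℕ} (h : IsSeg A B) : ¬ (StarSeg A B).Countable := by
  obtain ⟨G, hGF, hG, hFG⟩ := h.2.exists_infinite_subset_infinite_diff
  intro hc
  let g := Nat.nth (· ∈ (B \ A) \ G)
  have hg : Function.Injective g := Nat.nth_injective hFG
  have hm : ∀ n, g n ∈ (B \ A) \ G := Nat.nth_mem_of_infinite hFG
  have hmaps : ∀ T : Set ℕ, A ∪ G ∪ g '' T ∈ StarSeg A B := fun T =>
    ⟨hG.mono fun x hx => Or.inl (Or.inr hx), .of_subset fun x hx => Or.inl (Or.inl hx),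
      .of_subset (Set.union_subset (Set.union_subset h.1 fun x hx => (hGF hx).1)
        (Set.image_subset_iff.2 fun n _ => (hm n).1.1))⟩
  have hinj : Function.Injective fun T : Set ℕ => A ∪ G ∪ g '' T := by
    have key : ∀ (T : Set ℕ) n, n ∈ T ↔ g n ∈ A ∪ G ∪ g '' T := fun T n => by
      constructor
      · exact fun hn => Or.inr ⟨n, hn, rfl⟩
      · rintro ((hn | hn) | hn)
        · exact absurd hn (hm n).1.2
        · exact absurd hn (hm n).2
        · exact (hg.mem_set_image).1 hn
    intro T U hTU
    ext n
    rw [key T, key U]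
    exact Iff.of_eq (congrArg (g n ∈ ·) hTU)
  have huniv : (Set.univ : Set (Set ℕ)).Countable :=
    Set.MapsTo.countable_of_injOn (fun T _ => hmaps T) hinj.injOn hc
  have := Set.countable_univ_iff.1 huniv
  obtain ⟨e, he⟩ := exists_injective_nat (Set ℕ)
  exact Function.cantor_injective e he

theorem countable_setOf_almost_eq (A : Set ℕ) :
    {X : Set ℕ | AlmostSub A X ∧ AlmostSub X A}.Countable := by
  refine Set.MapsTo.countable_of_injOn (t := {s : Set ℕ | s.Finite}) (f := fun X => symmDiff X A)
    ?_ ?_ Set.Countable.ofPred_finite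
  · exact fun X hX => Set.Finite.union hX.2 hX.1
  · exact fun X _ Y _ h => symmDiff_left_injective A h

theorem isStarSeg_inter_of_not_countable {P Q : Set (Set ℕ)} (hP : IsStarSeg P)
    (hQ : IsStarSeg Q) (h : ¬ (P ∩ Q).Countable) : IsStarSeg (P ∩ Q) := by
  obtain ⟨A, B, -, rfl⟩ := hP
  obtain ⟨C, E, -, rfl⟩ := hQ
  obtain ⟨X, hX₁, hX₂⟩ : (StarSeg A B ∩ StarSeg C E).Nonempty := by
    by_contra hne
    exact h (by simp [Set.not_nonempty_iff_eq_empty.1 hne])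
  have hle : AlmostSub (A ∪ C) (B ∩ E) :=
    (hX₁.2.1.union hX₂.2.1).trans (hX₁.2.2.inter hX₂.2.2)
  have hmem : ∀ Y, Y ∈ StarSeg A B ∩ StarSeg C E ↔
      Y.Infinite ∧ AlmostSub (A ∪ C) Y ∧ AlmostSub Y (B ∩ E) := fun Y =>
    ⟨fun hY => ⟨hY.1.1, hY.1.2.1.union hY.2.2.1, hY.1.2.2.inter hY.2.2.2⟩, fun hY =>
      ⟨⟨hY.1, (AlmostSub.of_subset Set.subset_union_left).trans hY.2.1,
        hY.2.2.trans (.of_subset Set.inter_subset_left)⟩,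
       ⟨hY.1, (AlmostSub.of_subset Set.subset_union_right).trans hY.2.1,
        hY.2.2.trans (.of_subset Set.inter_subset_right)⟩⟩⟩
  refine ⟨(A ∪ C) ∩ (B ∩ E), B ∩ E, ⟨Set.inter_subset_right, fun hfin => h ?_⟩, ?_⟩
  · refine (countable_setOf_almost_eq (A ∪ C)).mono fun Y hY => ?_
    rw [hmem] at hY
    refine ⟨hY.2.1, hY.2.2.trans (hfin.subset fun x hx => ⟨hx.1, fun hx' => hx.2 hx'.1⟩)⟩
  · ext Y
    rw [hmem]
    exact ⟨fun hY => ⟨hY.1, (AlmostSub.of_subset Set.inter_subset_left).trans hY.2.1, hY.2.2⟩,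
      fun hY => ⟨hY.1, ((AlmostSub.of_subset subset_rfl).inter hle).trans hY.2.1, hY.2.2⟩⟩

theorem exists_isVPartition_subset {K : Set (Set (Set ℕ))} (hK : ∀ R ∈ K, IsStarSeg R)
    (hdense : ∀ R, IsStarSeg R → ∃ Q ∈ K, Q ⊆ R) : ∃ P ⊆ K, IsVPartition P := by
  obtain ⟨P, hP⟩ := zorn_subset {P | P ⊆ K ∧ P.Pairwise StarDisjoint} fun c hc hchain =>
    ⟨⋃₀ c, ⟨Set.sUnion_subset fun P hP => (hc hP).1,
      (Set.pairwise_sUnion hchain.directedOn).2 fun P hP => (hc hP).2⟩,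
      fun P hP => Set.subset_sUnion_of_mem hP⟩
  refine ⟨P, hP.prop.1, fun X hX => hK X (hP.prop.1 hX), hP.prop.2, fun R hR _ => ?_⟩
  obtain ⟨Q, hQK, hQR⟩ := hdense R hR
  by_contra! hdisj
  have hQdisj : ∀ X ∈ P, StarDisjoint Q X := fun X hX =>
    (hdisj X hX).mono (Set.inter_subset_inter_left X hQR)
  have hQP : Q ∈ P := by
    refine hP.le_of_ge (y := insert Q P) ⟨Set.insert_subset hQK hP.prop.1, ?_⟩
      (Set.subset_insert Q P) (Set.mem_insert Q P)
    refine hP.prop.2.insert fun X hX _ => ⟨hQdisj X hX, ?_⟩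
    rw [StarDisjoint, Set.inter_comm]
    exact hQdisj X hX
  obtain ⟨A, B, hAB, rfl⟩ := hK Q hQK
  exact not_countable_starSeg hAB (by simpa [StarDisjoint] using hQdisj _ hQP)

theorem IsVPartition.exists_not_countable_inter {P : Set (Set (Set ℕ))} (hP : IsVPartition P)
    {A B : Set ℕ} (hAB : IsSeg A B) : ∃ X ∈ P, ¬ (X ∩ StarSeg A B).Countable := by
  by_cases h : StarSeg A B ∈ P
  · exact ⟨_, h, by simpa using not_countable_starSeg hAB⟩
  · obtain ⟨X, hX, hX'⟩ := hP.2.2 _ ⟨A, B, hAB, rfl⟩ h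
    exact ⟨X, hX, by rwa [Set.inter_comm]⟩

theorem exists_seg_disjoint_of_not_almostSub {A B C E : Set ℕ} (hAB : IsSeg A B)
    (h : ¬ AlmostSub (B \ A) (E \ C)) :
    ∃ A' B', IsSeg A' B' ∧ A ⊆ A' ∧ B' ⊆ B ∧ StarSeg C E ∩ StarSeg A' B' = ∅ := by
  have hsplit : ((B \ A) \ E).Infinite ∨ ((B \ A) ∩ C).Infinite := by
    by_contra! hfin
    refine h ((hfin.1.union hfin.2).subset fun x hx => ?_)
    by_cases hE : x ∈ E
    · exact Or.inr ⟨hx.1, by_contra fun hC => hx.2 ⟨hE, hC⟩⟩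
    · exact Or.inl ⟨hx.1, hE⟩
  rcases hsplit with hinf | hinf
  · obtain ⟨F, hF, hFinf, hdiff⟩ := hinf.exists_infinite_subset_infinite_diff
    refine ⟨A ∪ F, B, ⟨Set.union_subset hAB.1 fun x hx => (hF hx).1.1, hdiff.mono fun x hx =>
      ⟨hx.1.1.1, fun hx' => hx'.elim hx.1.1.2 hx.2⟩⟩, Set.subset_union_left, subset_rfl, ?_⟩
    rw [Set.eq_empty_iff_forall_notMem]
    rintro X ⟨hX, hX'⟩
    exact hFinf ((hX'.2.1.trans hX.2.2).subset fun x hx => ⟨Or.inr hx, (hF hx).2⟩)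
  · obtain ⟨F, hF, hFinf, hdiff⟩ := hinf.exists_infinite_subset_infinite_diff
    refine ⟨A, B \ F, ⟨fun x hx => ⟨hAB.1 hx, fun hx' => (hF hx').1.2 hx⟩, hdiff.mono fun x hx =>
      ⟨⟨hx.1.1.1, hx.2⟩, hx.1.1.2⟩⟩, subset_rfl, Set.sdiff_subset, ?_⟩
    rw [Set.eq_empty_iff_forall_notMem]
    rintro X ⟨hX, hX'⟩
    exact hFinf ((hX.2.1.trans hX'.2.2).subset fun x hx => ⟨(hF hx).2, fun h => h.2 hx⟩)

/-- A v-partition splits `⟨A,B⟩*` when `B \ A` is not almost contained in the difference set of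
any of its members. -/
theorem IsVPartition.exists_split {P : Set (Set (Set ℕ))} (hP : IsVPartition P)
    {A B : Set ℕ} (hAB : IsSeg A B)
    (hsmall : ∀ X ∈ P, ∃ C E, X = StarSeg C E ∧ ¬ AlmostSub (B \ A) (E \ C)) :
    ∃ X ∈ P, ∃ Y ∈ P, X ≠ Y ∧
      IsStarSeg (X ∩ StarSeg A B) ∧ IsStarSeg (Y ∩ StarSeg A B) ∧
      X ∩ StarSeg A B ≠ Y ∩ StarSeg A B := by
  obtain ⟨X, hX, hXS⟩ := hP.exists_not_countable_inter hAB
  obtain ⟨C, E, rfl, hCE⟩ := hsmall X hX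
  obtain ⟨A', B', hAB', hA, hB, hempty⟩ := exists_seg_disjoint_of_not_almostSub hAB hCE
  obtain ⟨Y, hY, hYS'⟩ := hP.exists_not_countable_inter hAB'
  have hne : StarSeg C E ≠ Y := by
    rintro rfl
    exact hYS' (by simp [hempty])
  have hYS : ¬ (Y ∩ StarSeg A B).Countable := fun hc => hYS' (hc.mono
    (Set.inter_subset_inter_right Y (StarSeg.subset_of_almostSub (.of_subset hA) (.of_subset hB))))
  refine ⟨_, hX, Y, hY, hne, isStarSeg_inter_of_not_countable (hP.1 _ hX) ⟨A, B, hAB, rfl⟩ hXS,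
    isStarSeg_inter_of_not_countable (hP.1 _ hY) ⟨A, B, hAB, rfl⟩ hYS, fun heq => hXS ?_⟩
  have hXY : (StarSeg C E ∩ Y).Countable := hP.2.1 _ hX Y hY hne
  exact hXY.mono (Set.subset_inter Set.inter_subset_left (heq.trans_subset Set.inter_subset_left))

theorem exists_isVPartition_image_mem {D : Set (Set ℕ)} (hD : DenseIn D) {f : ℕ → ℕ}
    (hf : Function.Injective f) :
    ∃ P, IsVPartition P ∧ ∀ X ∈ P, ∃ C E, X = StarSeg C E ∧ f '' (E \ C) ∈ D := by
  obtain ⟨P, hPK, hP⟩ := exists_isVPartition_subset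
    (K := {R | ∃ C E, IsSeg C E ∧ R = StarSeg C E ∧ f '' (E \ C) ∈ D})
    (fun R ⟨C, E, hCE, hR, _⟩ => ⟨C, E, hCE, hR⟩) (by
      rintro _ ⟨A, B, hAB, rfl⟩
      obtain ⟨F, hFD, hFinf, hF⟩ := hD (f '' (B \ A)) (hAB.2.image hf.injOn)
      obtain ⟨G, hG, rfl⟩ := Set.subset_image_iff.1 hF
      have hdiff : (A ∪ G) \ A = G := by
        rw [Set.union_sdiff_left]
        exact (Set.disjoint_left.2 fun x hx => (hG hx).2).sdiff_eq_left
      refine ⟨_, ⟨A, A ∪ G, ⟨Set.subset_union_left, ?_⟩, rfl, ?_⟩,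
        StarSeg.subset_of_almostSub (.of_subset subset_rfl)
          (.of_subset (Set.union_subset hAB.1 fun x hx => (hG hx).1))⟩
      · rw [hdiff]
        exact hFinf.of_image f
      · rwa [hdiff])
  exact ⟨P, hP, fun X hX => let ⟨C, E, _, h, h'⟩ := hPK hX; ⟨C, E, h, h'⟩⟩

theorem exists_shattering_mk_le {Ds : Set (Set (Set ℕ))}
    (hDs : ∀ D ∈ Ds, OpenIn D ∧ DenseIn D) (hnd : ¬ DenseIn (⋂₀ Ds)) :
    ∃ H, Shattering H ∧ Cardinal.mk ↥H ≤ Cardinal.mk ↥Ds := by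
  simp only [DenseIn, not_forall, not_exists, not_and] at hnd
  obtain ⟨X₀, hX₀, hno⟩ := hnd
  let f := Nat.nth (· ∈ X₀)
  have hf : Function.Injective f := Nat.nth_injective hX₀
  choose P hP hPD using fun D : Ds => exists_isVPartition_image_mem (hDs D D.2).2 hf
  refine ⟨Set.range P, ⟨?_, fun A B hAB => ?_⟩, Cardinal.mk_range_le⟩
  · rintro _ ⟨D, rfl⟩
    exact hP D
  · have hnot : f '' (B \ A) ∉ ⋂₀ Ds := fun hmem => hno _ hmem (hAB.2.image hf.injOn)
      (Set.image_subset_iff.2 fun n _ => Nat.nth_mem_of_infinite hX₀ n)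
    simp only [Set.mem_sInter, not_forall] at hnot
    obtain ⟨D, hD, hBA⟩ := hnot
    refine ⟨_, ⟨⟨D, hD⟩, rfl⟩, (hP ⟨D, hD⟩).exists_split hAB fun X hX => ?_⟩
    obtain ⟨C, E, hX, hCE⟩ := hPD _ X hX
    refine ⟨C, E, hX, fun hsub => hBA ((hDs D hD).1 _ hCE _ (hAB.2.image hf.injOn) ?_)⟩
    rw [AlmostSub, ← Set.image_sdiff hf]
    exact Set.Finite.image f hsub

theorem exists_open_dense_family_not_dense : ∃ Ds : Set (Set (Set ℕ)),
    (∀ D ∈ Ds, (∀ A ∈ D, Set.Infinite A) ∧ OpenIn D ∧ DenseIn D) ∧ ¬ DenseIn (⋂₀ Ds) := by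
  refine ⟨Set.range fun X : {X : Set ℕ // X.Infinite} =>
    {A | A.Infinite ∧ ¬ AlmostSub X A}, ?_, fun h => ?_⟩
  · rintro _ ⟨⟨X, hX⟩, rfl⟩
    refine ⟨fun A hA => hA.1, fun B hB A hA hAB => ⟨hA, fun h => hB.2 (h.trans hAB)⟩,
      fun Y hY => ?_⟩
    obtain ⟨G, hG, hGinf, hdiff⟩ := hY.exists_infinite_subset_infinite_diff
    by_cases h : AlmostSub X G
    · refine ⟨Y \ G, ⟨hdiff, fun h' => hX ?_⟩, hdiff, Set.sdiff_subset⟩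
      refine Set.Finite.subset (Set.Finite.union h h') fun x hx => ?_
      by_cases hxG : x ∈ G
      · exact Or.inr ⟨hx, fun hx' => hx'.2 hxG⟩
      · exact Or.inl ⟨hx, hxG⟩
    · exact ⟨G, ⟨hGinf, h⟩, hGinf, hG⟩
  · obtain ⟨A, hA, hAinf, -⟩ := h Set.univ Set.infinite_univ
    exact (hA _ ⟨⟨A, hAinf⟩, rfl⟩).2 (.of_subset subset_rfl)

/-- Theorem 10 (part): `κ(v) ≤ h`. -/
theorem kappaV_le_hNum : kappaV ≤ hNum := by
  refine le_csInf ?_ ?_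
  · obtain ⟨Ds, h, h'⟩ := exists_open_dense_family_not_dense
    exact ⟨_, Ds, h, h', rfl⟩
  · rintro _ ⟨Ds, hDs, hnd, rfl⟩
    obtain ⟨H, hH, hle⟩ := exists_shattering_mk_le (fun D hD => (hDs D hD).2) hnd
    have hkappa : kappaV ≤ Cardinal.mk ↥H := csInf_le' ⟨H, hH, rfl⟩
    exact hkappa.trans hle
end
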